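/- Fix t̄ > 0 and let T : L²(−π,π) → L¹(−π,π) be the periodic heat operator at time t̄. Then there exists δ₀ > 0 such that for all 0 < δ ≤ δ₀ and all f ∈ L²(−π,π): ‖Tf‖_{L∞(−π,π)} ≤ (8·max{1, t̄^{−1/2}}/(exp(3t̄) − 1))·exp(−⌊π/δ − 1/2⌋²·t̄)·‖f‖_{L²(−π,π)} + (1/δ)·‖Tf‖_{L¹(−π,π)}. -/

import Mathlib

open scoped Real ENNReal
open MeasureTheory

/-- The `n`-th Fourier coefficient `f̂(n) = (1/2π) ∫_{-π}^{π} f(x) e^{-inx} dx`. -/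
noncomputable def fourierCoef (f : ℝ → ℂ) (n : ℤ) : ℂ :=
  (1 / (2 * π)) * ∫ x in (-π : ℝ)..π, f x * Complex.exp (-(Complex.I * n * x))

/-- The periodic heat operator at time `t̄`: `(T f)(x) = Σ_n exp(-n² t̄) f̂(n) e^{inx}`. -/
noncomputable def heatOp (tb : ℝ) (f : ℝ → ℂ) (x : ℝ) : ℂ :=
  ∑' n : ℤ, (Real.exp (-((n : ℝ) ^ 2 * tb)) : ℂ) * fourierCoef f n *
    Complex.exp (Complex.I * n * x)

theorem norm_exp_neg_I_mul_int_mul (n : ℤ) (x : ℝ) :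
    ‖Complex.exp (-(Complex.I * n * x))‖ = 1 := by
  rw [show -(Complex.I * n * x) = ((-(n * x) : ℝ) : ℂ) * Complex.I by push_cast; ring]
  exact Complex.norm_exp_ofReal_mul_I _

theorem norm_exp_I_mul_int_mul (n : ℤ) (x : ℝ) : ‖Complex.exp (Complex.I * n * x)‖ = 1 := by
  rw [show Complex.I * n * x = ((n * x : ℝ) : ℂ) * Complex.I by push_cast; ring]
  exact Complex.norm_exp_ofReal_mul_I _

theorem norm_fourierCoef_le_integral_norm (f : ℝ → ℂ) (n : ℤ) :
    ‖fourierCoef f n‖ ≤ 1 / (2 * π) * ∫ x in Set.Ioo (-π) π, ‖f x‖ := by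
  have hpi := Real.pi_pos
  have h : ‖∫ x in (-π : ℝ)..π, f x * Complex.exp (-(Complex.I * n * x))‖
      ≤ ∫ x in (-π : ℝ)..π, ‖f x‖ := by
    refine (intervalIntegral.norm_integral_le_integral_norm (by linarith)).trans_eq ?_
    simp only [norm_mul, norm_exp_neg_I_mul_int_mul, mul_one]
  have hc : ‖(1 / (2 * π) : ℂ)‖ = 1 / (2 * π) := by
    rw [show (1 / (2 * π) : ℂ) = ((1 / (2 * π) : ℝ) : ℂ) by push_cast; rfl, Complex.norm_real,
      Real.norm_of_nonneg (by positivity)]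
  rw [intervalIntegral.integral_of_le (f := fun x => ‖f x‖) (by linarith),
    integral_Ioc_eq_integral_Ioo] at h
  rw [fourierCoef, norm_mul, hc]
  gcongr

theorem norm_fourierCoef_le_eLpNorm {f : ℝ → ℂ}
    (hf : MemLp f 2 (volume.restrict (Set.Ioo (-π) π))) (n : ℤ) :
    ‖fourierCoef f n‖ ≤ (eLpNorm f 2 (volume.restrict (Set.Ioo (-π) π))).toReal := by
  have hpi := Real.pi_pos
  set μ := volume.restrict (Set.Ioo (-π) π)
  have hμ : μ Set.univ = ENNReal.ofReal (2 * π) := by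
    rw [Measure.restrict_apply_univ, Real.volume_Ioo]; ring_nf
  have h1 : eLpNorm f 1 μ ≤ eLpNorm f 2 μ * ENNReal.ofReal (2 * π) := by
    refine (eLpNorm_le_eLpNorm_mul_rpow_measure_univ (p := 1) (q := 2) (by norm_num) hf.1).trans ?_
    gcongr
    rw [hμ]
    refine (ENNReal.rpow_le_rpow_of_exponent_le (z := 1) ?_ (by norm_num)).trans_eq
      (ENNReal.rpow_one _)
    rw [← ENNReal.ofReal_one]
    exact ENNReal.ofReal_le_ofReal (by linarith [Real.pi_gt_three])
  have h2 : ∫ x, ‖f x‖ ∂μ ≤ (eLpNorm f 2 μ).toReal * (2 * π) := by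
    rw [integral_norm_eq_lintegral_enorm hf.1, ← eLpNorm_one_eq_lintegral_enorm]
    refine (ENNReal.toReal_mono (ENNReal.mul_ne_top hf.2.ne ENNReal.ofReal_ne_top) h1).trans_eq ?_
    rw [ENNReal.toReal_mul, ENNReal.toReal_ofReal (by positivity)]
  refine (norm_fourierCoef_le_integral_norm f n).trans ?_
  rw [one_div, inv_mul_le_iff₀ (by positivity), mul_comm]
  exact h2

theorem integral_exp_I_mul_int_mul (m : ℤ) :
    ∫ x in (-π : ℝ)..π, Complex.exp (Complex.I * m * x) = if m = 0 then 2 * (π : ℂ) else 0 := by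
  split_ifs with h
  · subst h
    simp
    ring
  · have hm : Complex.I * m ≠ 0 := by simp [h]
    rw [integral_exp_mul_complex hm, div_eq_zero_iff]
    left
    rw [sub_eq_zero, Complex.exp_eq_exp_iff_exists_int]
    exact ⟨m, by push_cast; ring⟩

theorem fourierCoef_tsum {c : ℤ → ℂ} (hc : Summable fun n => ‖c n‖) (n : ℤ) :
    fourierCoef (fun x => ∑' m : ℤ, c m * Complex.exp (Complex.I * m * x)) n = c n := by
  have hpi : (π : ℂ) ≠ 0 := by exact_mod_cast Real.pi_ne_zero
  have hswap : HasSum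
      (fun m : ℤ => ∫ x in (-π : ℝ)..π,
        c m * Complex.exp (Complex.I * m * x) * Complex.exp (-(Complex.I * n * x)))
      (∫ x in (-π : ℝ)..π, (∑' m : ℤ, c m * Complex.exp (Complex.I * m * x)) *
        Complex.exp (-(Complex.I * n * x))) := by
    refine intervalIntegral.hasSum_integral_of_dominated_convergence (fun m _ => ‖c m‖)
      (fun m => ?_) (fun m => ?_) ?_ ?_ ?_
    · exact Continuous.aestronglyMeasurable (by fun_prop)
    · refine Filter.Eventually.of_forall fun x _ => ?_
      simp only [norm_mul, norm_exp_I_mul_int_mul, norm_exp_neg_I_mul_int_mul, mul_one, le_refl]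
    · exact Filter.Eventually.of_forall fun x _ => hc
    · exact intervalIntegrable_const
    · refine Filter.Eventually.of_forall fun x _ => HasSum.mul_right _ (Summable.hasSum ?_)
      refine Summable.of_norm ?_
      simpa only [norm_mul, norm_exp_I_mul_int_mul, mul_one] using hc
  have hterm (m : ℤ) : ∫ x in (-π : ℝ)..π,
      c m * Complex.exp (Complex.I * m * x) * Complex.exp (-(Complex.I * n * x))
      = if m = n then 2 * π * c n else 0 := by
    have : ∀ x : ℝ, c m * Complex.exp (Complex.I * m * x) * Complex.exp (-(Complex.I * n * x))
        = c m * Complex.exp (Complex.I * (m - n : ℤ) * x) := fun x => by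
      rw [mul_assoc, ← Complex.exp_add]
      push_cast
      ring_nf
    simp only [this, intervalIntegral.integral_const_mul, integral_exp_I_mul_int_mul, sub_eq_zero]
    split_ifs with h
    · rw [h]; ring
    · simp
  simp only [hterm] at hswap
  rw [fourierCoef, hswap.unique (hasSum_ite_eq n (2 * π * c n))]
  field_simp

theorem hasSum_int_geometric_tail (k : ℕ) {q : ℝ} (h0 : 0 ≤ q) (h1 : q < 1) :
    HasSum (fun n : ℤ => if n.natAbs ≤ k then 0 else q ^ (n.natAbs - k))
      (2 * (q * (1 - q)⁻¹)) := by
  have hgeom := (hasSum_geometric_of_lt_one h0 h1).mul_left q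
  rw [two_mul]
  refine HasSum.of_nat_of_neg_add_one ?_ ?_
  · rw [← hasSum_nat_add_iff' (k + 1), Finset.sum_eq_zero, sub_zero]
    · refine hgeom.congr_fun fun i => ?_
      rw [if_neg (by omega), ← pow_succ']
      congr 1
      omega
    · intro i hi
      rw [Finset.mem_range] at hi
      exact if_pos (by omega)
  · rw [← hasSum_nat_add_iff' k, Finset.sum_eq_zero, sub_zero]
    · refine hgeom.congr_fun fun i => ?_
      rw [if_neg (by omega), ← pow_succ']
      congr 1
      omega
    · intro i hi
      rw [Finset.mem_range] at hi
      exact if_pos (by omega)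

theorem exp_neg_sq_mul_le {k m : ℕ} (hk : 1 ≤ k) (hm : k ≤ m) {t : ℝ} (ht : 0 ≤ t) :
    Real.exp (-((m : ℝ) ^ 2 * t)) ≤ Real.exp (-((k : ℝ) ^ 2 * t)) * Real.exp (-(3 * t)) ^ (m - k) := by
  obtain ⟨j, rfl⟩ := Nat.exists_eq_add_of_le hm
  rw [Nat.add_sub_cancel_left, ← Real.exp_nat_mul, ← Real.exp_add, Real.exp_le_exp]
  have hj : (3 * j : ℝ) ≤ 2 * k * j + j ^ 2 := by
    have : 3 * j ≤ 2 * k * j + j ^ 2 := by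
      rcases Nat.eq_zero_or_pos j with rfl | hj
      · simp
      · nlinarith
    exact_mod_cast this
  push_cast
  nlinarith [mul_le_mul_of_nonneg_right hj ht]

/-- If the coefficients of an exponential series are dominated by `N * exp (-n² t)`, then its
supremum is controlled by the `L¹` norm, which handles the frequencies up to `k`, plus a Gaussian
tail. -/
theorem norm_tsum_exp_le {c : ℤ → ℂ} {N t : ℝ} (ht : 0 < t)
    (hc : ∀ n, ‖c n‖ ≤ Real.exp (-((n : ℝ) ^ 2 * t)) * N) {k : ℕ} (hk : 1 ≤ k) (x : ℝ) :
    ‖∑' n : ℤ, c n * Complex.exp (Complex.I * n * x)‖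
      ≤ (2 * k + 1) * (1 / (2 * π) * ∫ y in Set.Ioo (-π) π,
          ‖∑' n : ℤ, c n * Complex.exp (Complex.I * n * y)‖)
        + Real.exp (-((k : ℝ) ^ 2 * t)) * N * (2 / (Real.exp (3 * t) - 1)) := by
  set B := 1 / (2 * π) * ∫ y in Set.Ioo (-π) π,
    ‖∑' n : ℤ, c n * Complex.exp (Complex.I * n * y)‖
  set q := Real.exp (-(3 * t)) with hq
  have hq1 : q < 1 := by rw [hq, Real.exp_lt_one_iff]; linarith
  have hN : 0 ≤ N := by
    have := (norm_nonneg _).trans (hc 0)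
    simpa using this
  have htail := (hasSum_int_geometric_tail k (Real.exp_nonneg _) hq1).mul_left
    (Real.exp (-((k : ℝ) ^ 2 * t)) * N)
  have hhead (D : ℝ) : HasSum (fun n : ℤ => if n ∈ Finset.Icc (-(k : ℤ)) k then D else 0)
      ((2 * k + 1) * D) := by
    have h := hasSum_sum_of_ne_finset_zero (L := .unconditional ℤ) (s := Finset.Icc (-(k : ℤ)) k)
      (f := fun n : ℤ => if n ∈ Finset.Icc (-(k : ℤ)) k then D else 0) (fun n hn => if_neg hn)
    rw [Finset.sum_ite_mem, Finset.inter_self, Finset.sum_const, Int.card_Icc, nsmul_eq_mul,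
      show ((k : ℤ) + 1 - -k).toNat = 2 * k + 1 by omega] at h
    exact_mod_cast h
  have hmaj {D : ℝ} (hD : ∀ n, ‖c n‖ ≤ D) (n : ℤ) :
      ‖c n‖ ≤ (if n ∈ Finset.Icc (-(k : ℤ)) k then D else 0) +
        Real.exp (-((k : ℝ) ^ 2 * t)) * N *
          (if n.natAbs ≤ k then 0 else q ^ (n.natAbs - k)) := by
    by_cases hn : n.natAbs ≤ k
    · rw [if_pos hn, if_pos (Finset.mem_Icc.2 (by omega)), mul_zero, add_zero]
      exact hD n
    · rw [if_neg hn, if_neg (by rw [Finset.mem_Icc]; omega), zero_add]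
      refine (hc n).trans ?_
      have h := exp_neg_sq_mul_le hk (le_of_not_ge hn) ht.le
      rw [Nat.cast_natAbs, Int.cast_abs, sq_abs] at h
      calc _ ≤ _ := mul_le_mul_of_nonneg_right h hN
        _ = _ := by ring
  have hcN (n : ℤ) : ‖c n‖ ≤ N :=
    (hc n).trans (mul_le_of_le_one_left hN (Real.exp_le_one_iff.2 (by
      have : 0 ≤ (n : ℝ) ^ 2 * t := by positivity
      linarith)))
  have hsum : Summable fun n => ‖c n‖ :=
    Summable.of_nonneg_of_le (fun _ => norm_nonneg _) (hmaj hcN) ((hhead N).add htail).summable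
  have hcB (n : ℤ) : ‖c n‖ ≤ B := by
    conv_lhs => rw [← fourierCoef_tsum hsum n]
    exact norm_fourierCoef_le_integral_norm _ n
  have hval : 2 * (q * (1 - q)⁻¹) = 2 / (Real.exp (3 * t) - 1) := by
    have h1 : 0 < Real.exp (3 * t) - 1 := by
      rw [sub_pos, Real.one_lt_exp_iff]; linarith
    have h2 : 1 - q ≠ 0 := by linarith
    have h3 : q * Real.exp (3 * t) = 1 := by rw [hq, ← Real.exp_add]; simp
    field_simp
    linarith
  rw [← hval]
  refine tsum_of_norm_bounded ((hhead B).add htail) fun n => ?_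
  rw [norm_mul, norm_exp_I_mul_int_mul, mul_one]
  exact hmaj hcB n

/-- `L^∞`-`L¹` interpolation inequality for the periodic heat operator
(Lemma 4.1, part 1 / Assumption 2.4): there is `δ₀ > 0` such that for all `0 < δ ≤ δ₀`
and all `f ∈ L²(-π,π)`,
`‖Tf‖_{L^∞} ≤ (8 max{1,t̄^{-1/2}}/(e^{3t̄}-1)) exp(-⌊π/δ-1/2⌋² t̄) ‖f‖_{L²} + (1/δ)‖Tf‖_{L¹}`. -/
theorem heat_interpolation_inequality (tb : ℝ) (htb : 0 < tb) :
    ∃ δ₀ : ℝ, 0 < δ₀ ∧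
      ∀ (δ : ℝ), 0 < δ → δ ≤ δ₀ →
      ∀ (f : ℝ → ℂ), MemLp f 2 (volume.restrict (Set.Ioo (-π) π)) →
      ∀ x ∈ Set.Ioo (-π) π,
        ‖heatOp tb f x‖
          ≤ (8 * max 1 (tb ^ (-(1 : ℝ) / 2)) / (Real.exp (3 * tb) - 1)) *
                Real.exp (-(((⌊π / δ - 1 / 2⌋ : ℤ) : ℝ) ^ 2 * tb)) *
                (eLpNorm f 2 (volume.restrict (Set.Ioo (-π) π))).toReal
            + (1 / δ) * ∫ y in Set.Ioo (-π) π, ‖heatOp tb f y‖ := by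
  refine ⟨1, one_pos, fun δ hδ hδ1 f hf x _ => ?_⟩
  set N := (eLpNorm f 2 (volume.restrict (Set.Ioo (-π) π))).toReal
  have hN : 0 ≤ N := ENNReal.toReal_nonneg
  have hK : 1 ≤ ⌊π / δ - 1 / 2⌋ := by
    rw [Int.le_floor]
    have : π ≤ π / δ := le_div_self Real.pi_pos.le hδ hδ1
    push_cast
    linarith [Real.pi_gt_three]
  obtain ⟨k, hk⟩ := Int.eq_ofNat_of_zero_le (zero_le_one.trans hK)
  have hkδ : (k : ℝ) ≤ π / δ - 1 / 2 := by
    have := Int.floor_le (π / δ - 1 / 2)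
    rw [hk] at this
    exact_mod_cast this
  rw [hk, Int.cast_natCast]
  have hc (n : ℤ) : ‖(Real.exp (-((n : ℝ) ^ 2 * tb)) : ℂ) * fourierCoef f n‖
      ≤ Real.exp (-((n : ℝ) ^ 2 * tb)) * N := by
    rw [norm_mul, Complex.norm_real, Real.norm_of_nonneg (Real.exp_nonneg _)]
    gcongr
    exact norm_fourierCoef_le_eLpNorm hf n
  have hmain := norm_tsum_exp_le htb hc (k := k) (by omega) x
  change ‖heatOp tb f x‖ ≤ (2 * k + 1) * (1 / (2 * π) * ∫ y in Set.Ioo (-π) π, ‖heatOp tb f y‖)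
    + _ at hmain
  have hI : 0 ≤ ∫ y in Set.Ioo (-π) π, ‖heatOp tb f y‖ :=
    integral_nonneg fun _ => norm_nonneg _
  have hhead : (2 * (k : ℝ) + 1) * (1 / (2 * π)) ≤ 1 / δ := by
    have hpi := Real.pi_pos
    calc (2 * (k : ℝ) + 1) * (1 / (2 * π)) ≤ (2 * (π / δ)) * (1 / (2 * π)) := by
          gcongr
          linarith
      _ = 1 / δ := by field_simp
  have hexp : 0 < Real.exp (3 * tb) - 1 := by
    rw [sub_pos, Real.one_lt_exp_iff]; linarith
  have htail : 2 / (Real.exp (3 * tb) - 1)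
      ≤ 8 * max 1 (tb ^ (-(1 : ℝ) / 2)) / (Real.exp (3 * tb) - 1) := by
    gcongr
    linarith [le_max_left 1 (tb ^ (-(1 : ℝ) / 2))]
  have h1 := mul_le_mul_of_nonneg_right hhead hI
  have h2 := mul_le_mul_of_nonneg_right htail
    (mul_nonneg (Real.exp_nonneg (-((k : ℝ) ^ 2 * tb))) hN)
  linarith
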